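/- arXiv:2412.13373 — 2 statements merged into one kernel-verified Lean document; each statement's English description precedes it below -/
import Mathlib

section
/- Let L̂ = MD. Then L̂ satisfies the modified reflection-equation relation R L̂₁ R L̂₁ − L̂₁ R L̂₁ R = R L̂₁ − L̂₁ R in Mat_{N²}(A), where L̂₁ = L̂ ⊗ I. -/
open scoped BigOperators

noncomputable section

/-- One-site embedding of an `N×N` matrix into `Mat_{N^k}` at 0-based position `i`
(the paper's `X_{i+1}` in 1-based numbering).  Out of range we return the identity. -/
def matAt {α : Type*} [Semiring α] (N k : ℕ) (X : Matrix (Fin N) (Fin N) α) (i : ℕ) :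
    Matrix (Fin k → Fin N) (Fin k → Fin N) α :=
  if h : i < k then
    Matrix.of fun a b =>
      if ∀ l : Fin k, (l : ℕ) ≠ i → a l = b l then X (a ⟨i, h⟩) (b ⟨i, h⟩) else 0
  else 1

/-- Two-site embedding of an operator on `V⊗V` into `Mat_{N^k}` at 0-based positions
`i, i+1` (the paper's `R_{i+1}` in 1-based numbering). -/
def opAt {α : Type*} [Semiring α] (N k : ℕ)
    (R : Matrix (Fin N × Fin N) (Fin N × Fin N) α) (i : ℕ) :
    Matrix (Fin k → Fin N) (Fin k → Fin N) α :=
  if h : i + 1 < k then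
    Matrix.of fun a b =>
      if ∀ l : Fin k, (l : ℕ) ≠ i → (l : ℕ) ≠ i + 1 → a l = b l then
        R (a ⟨i, by omega⟩, a ⟨i + 1, h⟩) (b ⟨i, by omega⟩, b ⟨i + 1, h⟩)
      else 0
  else 1

/-- A numeric (complex) matrix viewed inside `Mat(A)` via the unit of `A`. -/
def toA (A : Type*) [Semiring A] [Algebra ℂ A] {ι : Type*} (X : Matrix ι ι ℂ) :
    Matrix ι ι A :=
  X.map (algebraMap ℂ A)

/-- The braid relation `R₁R₂R₁ = R₂R₁R₂` on `V^{⊗3}`. -/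
def IsBraid (N : ℕ) (R : Matrix (Fin N × Fin N) (Fin N × Fin N) ℂ) : Prop :=
  opAt N 3 R 0 * opAt N 3 R 1 * opAt N 3 R 0 = opAt N 3 R 1 * opAt N 3 R 0 * opAt N 3 R 1

/-- The Hecke condition `(q·I − R)(q⁻¹·I + R) = 0`. -/
def IsHecke (N : ℕ) (q : ℂ) (R : Matrix (Fin N × Fin N) (Fin N × Fin N) ℂ) : Prop :=
  (q • (1 : Matrix (Fin N × Fin N) (Fin N × Fin N) ℂ) - R) * (q⁻¹ • 1 + R) = 0

/-- `q` is generic: `q ∉ {0, 1, −1}` and `qⁿ ≠ 1` for all positive integers `n`. -/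
def GenericQ (q : ℂ) : Prop :=
  q ≠ 0 ∧ q ≠ 1 ∧ q ≠ -1 ∧ ∀ n : ℕ, 0 < n → q ^ n ≠ 1

/-- The reflection-equation type relation `R X₁ R X₁ = X₁ R X₁ R` in `Mat_{N²}`. -/
def RErel {α : Type*} [Semiring α] (N : ℕ)
    (R : Matrix (Fin N × Fin N) (Fin N × Fin N) α) (X : Matrix (Fin N) (Fin N) α) : Prop :=
  opAt N 2 R 0 * matAt N 2 X 0 * opAt N 2 R 0 * matAt N 2 X 0 =
    matAt N 2 X 0 * opAt N 2 R 0 * matAt N 2 X 0 * opAt N 2 R 0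

/-- The quantum-double permutation relation `D₁ R M₁ R = R M₁ R⁻¹ D₁ + R` in `Mat_{N²}(A)`. -/
def PermRel {A : Type*} [Ring A] [Algebra ℂ A] (N : ℕ)
    (R Rinv : Matrix (Fin N × Fin N) (Fin N × Fin N) ℂ)
    (M D : Matrix (Fin N) (Fin N) A) : Prop :=
  matAt N 2 D 0 * opAt N 2 (toA A R) 0 * matAt N 2 M 0 * opAt N 2 (toA A R) 0 =
    opAt N 2 (toA A R) 0 * matAt N 2 M 0 * opAt N 2 (toA A Rinv) 0 * matAt N 2 D 0 +
      opAt N 2 (toA A R) 0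

/-- The homogeneous permutation relation `D₁ R M₁ R = R M₁ R⁻¹ D₁` in `Mat_{N²}(A)`. -/
def PermRelHom {A : Type*} [Ring A] [Algebra ℂ A] (N : ℕ)
    (R Rinv : Matrix (Fin N × Fin N) (Fin N × Fin N) ℂ)
    (M D : Matrix (Fin N) (Fin N) A) : Prop :=
  matAt N 2 D 0 * opAt N 2 (toA A R) 0 * matAt N 2 M 0 * opAt N 2 (toA A R) 0 =
    opAt N 2 (toA A R) 0 * matAt N 2 M 0 * opAt N 2 (toA A Rinv) 0 * matAt N 2 D 0

/-- Overline copies: `ovCopy … r = X_{⟨r+1⟩}`, i.e. `X_{⟨1⟩} = X⊗I⊗⋯⊗I` and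
`X_{⟨r+1⟩} = R_r X_{⟨r⟩} R_r⁻¹`. -/
def ovCopy {α : Type*} [Semiring α] (N k : ℕ)
    (R Rinv : Matrix (Fin N × Fin N) (Fin N × Fin N) α)
    (X : Matrix (Fin N) (Fin N) α) : ℕ → Matrix (Fin k → Fin N) (Fin k → Fin N) α
  | 0 => matAt N k X 0
  | r + 1 => opAt N k R r * ovCopy N k R Rinv X r * opAt N k Rinv r

/-- Underline copies: `unCopy … r = X_{[r+1]}`, i.e. `X_{[1]} = X⊗I⊗⋯⊗I` and
`X_{[r+1]} = R_r⁻¹ X_{[r]} R_r`. -/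
def unCopy {α : Type*} [Semiring α] (N k : ℕ)
    (R Rinv : Matrix (Fin N × Fin N) (Fin N × Fin N) α)
    (X : Matrix (Fin N) (Fin N) α) : ℕ → Matrix (Fin k → Fin N) (Fin k → Fin N) α
  | 0 => matAt N k X 0
  | r + 1 => opAt N k Rinv r * unCopy N k R Rinv X r * opAt N k R r

/-- `X_{⟨1→n⟩} = X_{⟨1⟩}X_{⟨2⟩}⋯X_{⟨n⟩}`. -/
def ovProd {α : Type*} [Semiring α] (N k : ℕ)
    (R Rinv : Matrix (Fin N × Fin N) (Fin N × Fin N) α)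
    (X : Matrix (Fin N) (Fin N) α) (n : ℕ) : Matrix (Fin k → Fin N) (Fin k → Fin N) α :=
  ((List.range n).map (ovCopy N k R Rinv X)).prod

/-- `X_{⟨n→1⟩} = X_{⟨n⟩}X_{⟨n−1⟩}⋯X_{⟨1⟩}`. -/
def ovProdRev {α : Type*} [Semiring α] (N k : ℕ)
    (R Rinv : Matrix (Fin N × Fin N) (Fin N × Fin N) α)
    (X : Matrix (Fin N) (Fin N) α) (n : ℕ) : Matrix (Fin k → Fin N) (Fin k → Fin N) α :=
  ((List.range n).reverse.map (ovCopy N k R Rinv X)).prod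

/-- Shifted Jucys–Murphy matrices: `JMup … R n s = J_{s+1}^{↑n}`, i.e. `J₁^{↑n} = I` and
`J_{s+1}^{↑n} = R_{n+s} J_s^{↑n} R_{n+s}` (paper's 1-based `R_{n+s}` is `opAt … (n+s-1)`).
Applying it to `R⁻¹` produces `(J_{s+1}^{↑n})⁻¹`. -/
def JMup {α : Type*} [Semiring α] (N k : ℕ)
    (R : Matrix (Fin N × Fin N) (Fin N × Fin N) α) (n : ℕ) :
    ℕ → Matrix (Fin k → Fin N) (Fin k → Fin N) α
  | 0 => 1
  | s + 1 => opAt N k R (n + s) * JMup N k R n s * opAt N k R (n + s)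

/-- The quantum trace `Tr_{R(1…n)}(X) = Tr(C₁C₂⋯C_n X)`. -/
def qTr {α : Type*} [Semiring α] (N n : ℕ) (C : Matrix (Fin N) (Fin N) α)
    (X : Matrix (Fin n → Fin N) (Fin n → Fin N) α) : α :=
  Matrix.trace (((List.range n).map (matAt N n C)).prod * X)

/-- The matrix `C`, `C_i^j = Σ_k Ψ_{ik}^{jk}`. -/
def traceMat (N : ℕ) (Ψ : Matrix (Fin N × Fin N) (Fin N × Fin N) ℂ) :
    Matrix (Fin N) (Fin N) ℂ :=
  Matrix.of fun i j => ∑ k, Ψ (i, k) (j, k)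

/-- Skew-invertibility of `R`: `Tr₂(R₁₂Ψ₂₃) = Tr₂(Ψ₁₂R₂₃) = P₁₃`, written componentwise. -/
def SkewInv (N : ℕ) (R Ψ : Matrix (Fin N × Fin N) (Fin N × Fin N) ℂ) : Prop :=
  (∀ i k l n : Fin N, ∑ j, ∑ b, R (i, j) (l, b) * Ψ (b, k) (j, n) =
      if i = n ∧ k = l then 1 else 0) ∧
  (∀ i k l n : Fin N, ∑ j, ∑ b, Ψ (i, j) (l, b) * R (b, k) (j, n) =
      if i = n ∧ k = l then 1 else 0)

/-- The generators `R₁, …, R_{n−1}` (1-based) of the Hecke-algebra image inside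
`End(V^{⊗k})`, as a subset of `Mat_{N^k}`. -/
def genSet {α : Type*} [Semiring α] (N k n : ℕ)
    (R : Matrix (Fin N × Fin N) (Fin N × Fin N) α) :
    Set (Matrix (Fin k → Fin N) (Fin k → Fin N) α) :=
  {X | ∃ i : ℕ, i + 1 < n ∧ X = opAt N k R i}

/-- The left ideal of `A` generated by the entries of `D`. -/
def entryIdeal (A : Type*) [Ring A] {N : ℕ} (D : Matrix (Fin N) (Fin N) A) :
    Submodule A A :=
  Submodule.span A {x : A | ∃ i j : Fin N, x = D i j}

/-- The normally ordered monomial `:L̂_{⟨1→k⟩}: = M_{⟨1→k⟩} D_{⟨k→1⟩} ∏_{s=1}^{k} J_s⁻¹`. -/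
def normOrd {α : Type*} [Semiring α] (N k : ℕ)
    (R Rinv : Matrix (Fin N × Fin N) (Fin N × Fin N) α)
    (M D : Matrix (Fin N) (Fin N) α) (n : ℕ) :
    Matrix (Fin k → Fin N) (Fin k → Fin N) α :=
  ovProd N k R Rinv M n * ovProdRev N k R Rinv D n *
    ((List.range n).map (fun s => JMup N k Rinv 0 s)).prod

theorem opAt_two_eq_submatrix {α : Type*} [Semiring α] (N : ℕ)
    (X : Matrix (Fin N × Fin N) (Fin N × Fin N) α) :
    opAt N 2 X 0 = X.submatrix (finTwoArrowEquiv (Fin N)) (finTwoArrowEquiv (Fin N)) := by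
  ext a b
  simp [opAt, finTwoArrowEquiv]

theorem opAt_two_mul {α : Type*} [Semiring α] (N : ℕ)
    (X Y : Matrix (Fin N × Fin N) (Fin N × Fin N) α) :
    opAt N 2 (X * Y) 0 = opAt N 2 X 0 * opAt N 2 Y 0 := by
  simp only [opAt_two_eq_submatrix, Matrix.submatrix_mul_equiv]

theorem opAt_two_one {α : Type*} [Semiring α] (N : ℕ) :
    opAt N 2 (1 : Matrix (Fin N × Fin N) (Fin N × Fin N) α) 0 = 1 := by
  simp only [opAt_two_eq_submatrix, Matrix.submatrix_one_equiv]

theorem matAt_two_mul {α : Type*} [Semiring α] (N : ℕ) (X Y : Matrix (Fin N) (Fin N) α) :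
    matAt N 2 (X * Y) 0 = matAt N 2 X 0 * matAt N 2 Y 0 := by
  ext a b
  rw [Matrix.mul_apply, ← (finTwoArrowEquiv (Fin N)).symm.sum_comp, Fintype.sum_prod_type]
  by_cases h : a 1 = b 1 <;>
    simp [matAt, finTwoArrowEquiv, Matrix.mul_apply, Fin.forall_fin_two, h]

theorem toA_mul_eq_one {A : Type*} [Semiring A] [Algebra ℂ A] {ι : Type*} [Fintype ι]
    [DecidableEq ι] {X Y : Matrix ι ι ℂ} (h : X * Y = 1) : toA A X * toA A Y = 1 := by
  rw [toA, toA, ← Matrix.map_mul, h, Matrix.map_one _ (map_zero _) (map_one _)]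

/-- In a ring, the reflection equations for `m` and `d` together with the permutation relation
between them imply the modified reflection equation for `m * d`. -/
theorem modified_reflection_of_permutation {B : Type*} [Ring B] {r s m d : B}
    (hrs : r * s = 1) (hsr : s * r = 1)
    (hm : r * m * r * m = m * r * m * r) (hd : s * d * s * d = d * s * d * s)
    (hdm : d * r * m * r = r * m * s * d + r) :
    r * (m * d) * r * (m * d) - m * d * r * (m * d) * r = r * (m * d) - m * d * r := by
  have hdm' : d * r * m = r * m * s * d * s + 1 := by
    calc d * r * m = d * r * m * r * s := by rw [mul_assoc _ r s, hrs, mul_one]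
      _ = r * m * s * d * s + 1 := by rw [hdm, add_mul, hrs]
  have hcomm : r * m * r * m * (s * d * s * d) = m * r * m * (s * d * s * d) * r := by
    calc r * m * r * m * (s * d * s * d) = m * r * m * (r * s) * (d * s * d) := by
          rw [hm]; noncomm_ring
      _ = m * r * m * (d * s * d) * (s * r) := by rw [hrs, hsr, mul_one, mul_one]
      _ = m * r * m * (d * s * d * s) * r := by noncomm_ring
      _ = m * r * m * (s * d * s * d) * r := by rw [hd]
  calc r * (m * d) * r * (m * d) - m * d * r * (m * d) * r
      = r * m * (d * r * m) * d - m * (d * r * m) * d * r := by noncomm_ring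
    _ = (r * m * r * m * (s * d * s * d) + r * (m * d)) -
          (m * r * m * (s * d * s * d) * r + m * d * r) := by
        rw [hdm']; noncomm_ring
    _ = r * (m * d) - m * d * r := by rw [hcomm, add_sub_add_left_eq_sub]

/-- `L̂ = MD` satisfies the modified reflection-equation relation
`R L̂₁ R L̂₁ − L̂₁ R L̂₁ R = R L̂₁ − L̂₁ R` in `Mat_{N²}(A)`. -/
theorem stmt0 {A : Type*} [Ring A] [Algebra ℂ A] (N : ℕ) (hN : 1 ≤ N) (q : ℂ)
    (hq : GenericQ q)
    (R Rinv : Matrix (Fin N × Fin N) (Fin N × Fin N) ℂ)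
    (hRinv : R * Rinv = 1 ∧ Rinv * R = 1)
    (hbraid : IsBraid N R) (hHecke : IsHecke N q R)
    (M D : Matrix (Fin N) (Fin N) A)
    (hM : RErel N (toA A R) M)
    (hD : RErel N (toA A Rinv) D)
    (hDM : PermRel N R Rinv M D) :
    opAt N 2 (toA A R) 0 * matAt N 2 (M * D) 0 * opAt N 2 (toA A R) 0 * matAt N 2 (M * D) 0 -
        matAt N 2 (M * D) 0 * opAt N 2 (toA A R) 0 * matAt N 2 (M * D) 0 *
          opAt N 2 (toA A R) 0 =
      opAt N 2 (toA A R) 0 * matAt N 2 (M * D) 0 -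
        matAt N 2 (M * D) 0 * opAt N 2 (toA A R) 0 := by
  rw [matAt_two_mul]
  refine modified_reflection_of_permutation (s := opAt N 2 (toA A Rinv) 0) ?_ ?_ hM hD hDM
  · rw [← opAt_two_mul, toA_mul_eq_one hRinv.1, opAt_two_one]
  · rw [← opAt_two_mul, toA_mul_eq_one hRinv.2, opAt_two_one]
end
end

section
/- Let X be any N×N matrix over A satisfying R X₁ R X₁ = X₁ R X₁ R. Define overline copies X_{⟨1⟩} = X ⊗ I^{⊗(n−1)}, X_{⟨r+1⟩} = R_r X_{⟨r⟩} R_r⁻¹ and underline copies X_{[1]} = X ⊗ I^{⊗(n−1)}, X_{[r+1]} = R_r⁻¹ X_{[r]} R_r. Then for every n ≥ 1 the identity X_{[n]} X_{[n−1]} ⋯ X_{[1]} = X_{⟨1⟩} X_{⟨2⟩} ⋯ X_{⟨n⟩} holds in Mat_{N^n}(A). -/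
open scoped BigOperators

noncomputable section

section ReflectionEquation

variable {G : Type*} [Monoid G]

/-- Conjugating by a braid generator transports a solution of the reflection equation to the
next pair of tensor factors. -/
theorem reflection_conj {g h : Gˣ} {o : G} (hb : g * h * g = h * g * h) (hc : Commute (h : G) o)
    (hr : (g : G) * o * g * o = o * g * o * g) :
    (h : G) * (g * o * ↑g⁻¹) * h * (g * o * ↑g⁻¹) =
      (g * o * ↑g⁻¹) * h * (g * o * ↑g⁻¹) * h := by
  have h1 : (↑g⁻¹ : G) * h * g = h * g * ↑h⁻¹ := by
    have : g⁻¹ * h * g = h * g * h⁻¹ := by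
      rw [eq_mul_inv_iff_mul_eq, mul_assoc, mul_assoc, inv_mul_eq_iff_eq_mul, ← mul_assoc,
        ← mul_assoc, hb]
    exact_mod_cast congrArg Units.val this
  have h2 : (↑h⁻¹ : G) * ↑g⁻¹ * h = g * ↑h⁻¹ * ↑g⁻¹ := by
    have : h⁻¹ * g⁻¹ * h = g * h⁻¹ * g⁻¹ := by
      rw [eq_mul_inv_iff_mul_eq, eq_mul_inv_iff_mul_eq, mul_assoc, mul_assoc, mul_assoc,
        inv_mul_eq_iff_eq_mul, inv_mul_eq_iff_eq_mul]
      simpa only [mul_assoc] using hb.symm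
    exact_mod_cast congrArg Units.val this
  have hb' : (g : G) * h * g = h * g * h := by exact_mod_cast congrArg Units.val hb
  have hc' : (↑h⁻¹ : G) * o = o * ↑h⁻¹ := hc.units_inv_left.eq
  have hmid : (o : G) * ↑g⁻¹ * h * g * o = h * o * g * o * ↑h⁻¹ := by
    calc (o : G) * ↑g⁻¹ * h * g * o = o * (↑g⁻¹ * h * g) * o := by simp only [mul_assoc]
      _ = (o * h) * g * (↑h⁻¹ * o) := by rw [h1]; simp only [mul_assoc]
      _ = h * o * g * o * ↑h⁻¹ := by rw [hc', ← hc.eq]; simp only [mul_assoc]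
  calc (h : G) * (g * o * ↑g⁻¹) * h * (g * o * ↑g⁻¹)
      = h * g * (o * ↑g⁻¹ * h * g * o) * ↑g⁻¹ := by simp only [mul_assoc]
    _ = (h * g * h) * o * g * o * ↑h⁻¹ * ↑g⁻¹ := by rw [hmid]; simp only [mul_assoc]
    _ = g * h * (g * o * g * o) * ↑h⁻¹ * ↑g⁻¹ := by rw [← hb']; simp only [mul_assoc]
    _ = g * (h * o * g * o) * (g * ↑h⁻¹ * ↑g⁻¹) := by rw [hr]; simp only [mul_assoc]
    _ = g * (h * o * g * o * ↑h⁻¹) * ↑g⁻¹ * h := by rw [← h2]; simp only [mul_assoc]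
    _ = (g * o * ↑g⁻¹) * h * (g * o * ↑g⁻¹) * h := by rw [← hmid]; simp only [mul_assoc]

variable {k : ℕ} {g : ℕ → Gˣ} {o u : ℕ → G}

theorem commute_overline
    (hfar : ∀ i j, i + 1 < j → j + 1 < k → Commute (g j) (g i))
    (h0 : ∀ j, 0 < j → j + 1 < k → Commute (g j : G) (o 0))
    (ho : ∀ r, o (r + 1) = g r * o r * ↑(g r)⁻¹) (r : ℕ) :
    ∀ j, r < j → j + 1 < k → Commute (g j : G) (o r) := by
  induction r with
  | zero => exact h0
  | succ r ih =>
    intro j hj hjk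
    have hg : Commute (g j : G) (g r) := (hfar r j hj hjk).map (Units.coeHom G)
    rw [ho]
    exact (hg.mul_right (ih j (by omega) hjk)).mul_right hg.units_inv_right

theorem reflection_overline
    (hbr : ∀ i, i + 2 < k → g i * g (i + 1) * g i = g (i + 1) * g i * g (i + 1))
    (hc : ∀ r j, r < j → j + 1 < k → Commute (g j : G) (o r))
    (h0 : 1 < k → (g 0 : G) * o 0 * g 0 * o 0 = o 0 * g 0 * o 0 * g 0)
    (ho : ∀ r, o (r + 1) = g r * o r * ↑(g r)⁻¹) (r : ℕ) (hr : r + 1 < k) :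
    (g r : G) * o r * g r * o r = o r * g r * o r * g r := by
  induction r with
  | zero => exact h0 hr
  | succ r ih =>
    rw [ho]
    exact reflection_conj (hbr r hr) (hc r (r + 1) (by omega) hr) (ih (by omega))

/-- The product of overline copies intertwines the next underline and overline copies. -/
theorem underline_mul_prod_overline
    (hc : ∀ r j, r < j → j + 1 < k → Commute (g j : G) (o r))
    (href : ∀ r, r + 1 < k → (g r : G) * o r * g r * o r = o r * g r * o r * g r)
    (h0 : u 0 = o 0) (ho : ∀ r, o (r + 1) = g r * o r * ↑(g r)⁻¹)
    (hu : ∀ r, u (r + 1) = ↑(g r)⁻¹ * u r * g r) (r : ℕ) (hr : r < k) :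
    u r * ((List.range r).map o).prod = ((List.range r).map o).prod * o r := by
  induction r with
  | zero => simp [h0]
  | succ r ih =>
    have hP : Commute (g r : G) ((List.range r).map o).prod := by
      refine Commute.list_prod_right _ _ fun y hy => ?_
      obtain ⟨s, hs, rfl⟩ := List.mem_map.1 hy
      exact hc s r (List.mem_range.1 hs) hr
    have hstep : (↑(g r)⁻¹ : G) * o r * g r * o r = o r * g r * o r * ↑(g r)⁻¹ := by
      rw [Units.eq_mul_inv_iff_mul_eq]
      simp only [mul_assoc]
      rw [Units.inv_mul_eq_iff_eq_mul]
      simpa only [mul_assoc] using (href r hr).symm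
    rw [List.range_succ, List.map_append, List.prod_append, List.map_singleton,
      List.prod_singleton, hu, ho]
    generalize ((List.range r).map o).prod = P at *
    calc (↑(g r)⁻¹ : G) * u r * g r * (P * o r)
        = ↑(g r)⁻¹ * u r * (g r * P) * o r := by simp only [mul_assoc]
      _ = ↑(g r)⁻¹ * (u r * P) * g r * o r := by rw [hP.eq]; simp only [mul_assoc]
      _ = (↑(g r)⁻¹ * P) * o r * g r * o r := by rw [ih (by omega)]; simp only [mul_assoc]
      _ = P * (↑(g r)⁻¹ * o r * g r * o r) := by
        rw [hP.units_inv_left.eq]; simp only [mul_assoc]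
      _ = P * o r * (g r * o r * ↑(g r)⁻¹) := by rw [hstep]; simp only [mul_assoc]

theorem prod_underline_eq_prod_overline
    (hbr : ∀ i, i + 2 < k → g i * g (i + 1) * g i = g (i + 1) * g i * g (i + 1))
    (hfar : ∀ i j, i + 1 < j → j + 1 < k → Commute (g j) (g i))
    (hc0 : ∀ j, 0 < j → j + 1 < k → Commute (g j : G) (o 0))
    (hr0 : 1 < k → (g 0 : G) * o 0 * g 0 * o 0 = o 0 * g 0 * o 0 * g 0)
    (h0 : u 0 = o 0) (ho : ∀ r, o (r + 1) = g r * o r * ↑(g r)⁻¹)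
    (hu : ∀ r, u (r + 1) = ↑(g r)⁻¹ * u r * g r) (r : ℕ) (hr : r ≤ k) :
    ((List.range r).reverse.map u).prod = ((List.range r).map o).prod := by
  have hc := commute_overline hfar hc0 ho
  induction r with
  | zero => simp
  | succ r ih =>
    have key := underline_mul_prod_overline hc (reflection_overline hbr hc hr0 ho) h0 ho hu r hr
    simp only [List.range_succ, List.reverse_append, List.map_append, List.prod_append,
      List.reverse_singleton, List.map_singleton, List.prod_singleton, ih (by omega), key]

end ReflectionEquation

section Embedding

variable {α : Type*} [Semiring α] {N m k : ℕ}

/-- The embedding of `Mat_{N^m}` into `Mat_{N^k}` acting in the tensor factors selected by `e`. -/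
def embAt (e : Fin m → Fin k) (M : Matrix (Fin m → Fin N) (Fin m → Fin N) α) :
    Matrix (Fin k → Fin N) (Fin k → Fin N) α :=
  open Classical in
  Matrix.of fun a b => if ∀ l, l ∉ Set.range e → a l = b l then M (a ∘ e) (b ∘ e) else 0

theorem embAt_mul {e : Fin m → Fin k} (he : Function.Injective e)
    (M M' : Matrix (Fin m → Fin N) (Fin m → Fin N) α) :
    embAt e (M * M') = embAt e M * embAt e M' := by
  classical
  ext a b
  simp only [embAt, Matrix.of_apply, Matrix.mul_apply]
  set F : (Fin m → Fin N) → Fin k → Fin N := fun c => Function.extend e c a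
  have hFe : ∀ c, F c ∘ e = c := fun c => Function.extend_comp he c a
  have hFo : ∀ c l, l ∉ Set.range e → F c l = a l := fun c l hl =>
    Function.extend_apply' _ _ _ (by simpa using hl)
  have hinj : Function.Injective F := fun c c' h => by rw [← hFe c, h, hFe]
  rw [← Finset.sum_subset (Finset.subset_univ (Finset.univ.map ⟨F, hinj⟩)), Finset.sum_map]
  · by_cases h : ∀ l, l ∉ Set.range e → a l = b l
    · rw [if_pos h]
      refine Finset.sum_congr rfl fun c _ => ?_
      rw [Function.Embedding.coeFn_mk, if_pos fun l hl => (hFo c l hl).symm,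
        if_pos fun l hl => (hFo c l hl).trans (h l hl), hFe]
    · rw [if_neg h]
      refine (Finset.sum_eq_zero fun c _ => ?_).symm
      have hn : ¬∀ l, l ∉ Set.range e → F c l = b l := fun h' =>
        h fun l hl => (hFo c l hl).symm.trans (h' l hl)
      rw [Function.Embedding.coeFn_mk, if_neg hn, mul_zero]
  · intro c _ hc
    rw [if_neg, zero_mul]
    intro h
    refine hc (Finset.mem_map.2 ⟨c ∘ e, Finset.mem_univ _, funext fun l => ?_⟩)
    by_cases hl : l ∈ Set.range e
    · obtain ⟨j, rfl⟩ := hl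
      exact congrFun (hFe (c ∘ e)) j
    · exact (hFo _ l hl).trans (h l hl)

theorem embAt_one (e : Fin m → Fin k) :
    embAt e (1 : Matrix (Fin m → Fin N) (Fin m → Fin N) α) = 1 := by
  classical
  ext a b
  simp only [embAt, Matrix.of_apply, Matrix.one_apply, ← ite_and]
  congr 1
  refine propext ⟨fun ⟨h, h'⟩ => funext fun l => ?_, fun h => by simp [h]⟩
  by_cases hl : l ∈ Set.range e
  · obtain ⟨j, rfl⟩ := hl
    exact congrFun h' j
  · exact h l hl

theorem embAt_mul_embAt_apply {m' : ℕ} {e : Fin m → Fin k} {f : Fin m' → Fin k}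
    (hef : Disjoint (Set.range e) (Set.range f))
    (M : Matrix (Fin m → Fin N) (Fin m → Fin N) α)
    (M' : Matrix (Fin m' → Fin N) (Fin m' → Fin N) α) (a b : Fin k → Fin N)
    [Decidable (∀ l, l ∉ Set.range e → l ∉ Set.range f → a l = b l)] :
    (embAt e M * embAt f M') a b =
      if ∀ l, l ∉ Set.range e → l ∉ Set.range f → a l = b l then
        M (a ∘ e) (b ∘ e) * M' (a ∘ f) (b ∘ f) else 0 := by
  classical
  simp only [embAt, Matrix.of_apply, Matrix.mul_apply]
  rw [Finset.sum_eq_single ((Set.range e).piecewise b a)]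
  · have he : (Set.range e).piecewise b a ∘ e = b ∘ e := by
      ext j; simp
    have hf : (Set.range e).piecewise b a ∘ f = a ∘ f := by
      funext j
      exact Set.piecewise_eq_of_notMem _ _ _ (hef.symm.notMem_of_mem_left ⟨j, rfl⟩)
    rw [he, hf, if_pos fun l hl => (Set.piecewise_eq_of_notMem _ _ _ hl).symm, mul_ite, mul_zero]
    congr 1
    refine propext ⟨fun h l hl hl' => ?_, fun h l hl' => ?_⟩
    · rw [← h l hl', Set.piecewise_eq_of_notMem _ _ _ hl]
    · by_cases hl : l ∈ Set.range e
      · rw [Set.piecewise_eq_of_mem _ _ _ hl]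
      · rw [Set.piecewise_eq_of_notMem _ _ _ hl, h l hl hl']
  · intro c _ hc
    by_contra hne
    have h1 := (ite_ne_right_iff.1 (left_ne_zero_of_mul hne)).1
    have h2 := (ite_ne_right_iff.1 (right_ne_zero_of_mul hne)).1
    refine hc (funext fun l => ?_)
    by_cases hl : l ∈ Set.range e
    · rw [Set.piecewise_eq_of_mem _ _ _ hl, h2 l (hef.notMem_of_mem_left hl)]
    · rw [Set.piecewise_eq_of_notMem _ _ _ hl, h1 l hl]
  · simp

theorem commute_embAt {m' : ℕ} {e : Fin m → Fin k} {f : Fin m' → Fin k}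
    (hef : Disjoint (Set.range e) (Set.range f))
    {M : Matrix (Fin m → Fin N) (Fin m → Fin N) α}
    {M' : Matrix (Fin m' → Fin N) (Fin m' → Fin N) α}
    (h : ∀ a b c d, Commute (M a b) (M' c d)) :
    Commute (embAt e M) (embAt f M') := by
  classical
  refine Matrix.ext fun a b => ?_
  rw [embAt_mul_embAt_apply hef, embAt_mul_embAt_apply hef.symm, (h _ _ _ _).eq]
  congr 1
  exact propext ⟨fun h l hl hl' => h l hl' hl, fun h l hl hl' => h l hl' hl⟩

/-- The consecutive tensor factors `s, …, s + m - 1`. -/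
def shiftFin {s : ℕ} (h : s + m ≤ k) (l : Fin m) : Fin k := ⟨s + l, by omega⟩

theorem shiftFin_injective {s : ℕ} (h : s + m ≤ k) :
    Function.Injective (shiftFin h) := fun a b hab => by
  simpa [shiftFin, Fin.ext_iff] using hab

theorem mem_range_shiftFin {s : ℕ} (h : s + m ≤ k) (l : Fin k) :
    l ∈ Set.range (shiftFin h) ↔ s ≤ l ∧ (l : ℕ) < s + m := by
  constructor
  · rintro ⟨j, rfl⟩
    simp [shiftFin]
  · rintro ⟨h1, h2⟩
    exact ⟨⟨l - s, by omega⟩, Fin.ext (by simp [shiftFin]; omega)⟩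

theorem disjoint_range_shiftFin {s t m' : ℕ} (h : s + m ≤ k) (h' : t + m' ≤ k)
    (hst : s + m ≤ t) : Disjoint (Set.range (shiftFin h)) (Set.range (shiftFin h')) := by
  rw [Set.disjoint_left]
  intro l
  rw [mem_range_shiftFin, mem_range_shiftFin]
  omega

theorem embAt_shiftFin_opAt (R : Matrix (Fin N × Fin N) (Fin N × Fin N) α) {s i : ℕ}
    (h : s + m ≤ k) (hi : i + 1 < m) :
    embAt (shiftFin h) (opAt N m R i) = opAt N k R (s + i) := by
  classical
  ext a b
  rw [opAt, opAt, dif_pos hi, dif_pos (by omega)]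
  simp only [embAt, Matrix.of_apply, ← ite_and]
  refine ite_congr (propext ?_) (fun _ => rfl) fun _ => rfl
  constructor
  · rintro ⟨h1, h2⟩ l hl hl'
    by_cases hm : l ∈ Set.range (shiftFin h)
    · obtain ⟨j, rfl⟩ := hm
      exact h2 j (by simp [shiftFin] at hl; omega) (by simp [shiftFin] at hl'; omega)
    · exact h1 l hm
  · refine fun H => ⟨fun l hl => ?_, fun l hl hl' => ?_⟩
    · rw [mem_range_shiftFin] at hl
      exact H l (by omega) (by omega)
    · exact H _ (by simp [shiftFin]; omega) (by simp [shiftFin]; omega)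

theorem embAt_shiftFin_matAt (X : Matrix (Fin N) (Fin N) α) {s i : ℕ}
    (h : s + m ≤ k) (hi : i < m) :
    embAt (shiftFin h) (matAt N m X i) = matAt N k X (s + i) := by
  classical
  ext a b
  rw [matAt, matAt, dif_pos hi, dif_pos (by omega)]
  simp only [embAt, Matrix.of_apply, ← ite_and]
  refine ite_congr (propext ?_) (fun _ => rfl) fun _ => rfl
  constructor
  · rintro ⟨h1, h2⟩ l hl
    by_cases hm : l ∈ Set.range (shiftFin h)
    · obtain ⟨j, rfl⟩ := hm
      exact h2 j (by simp [shiftFin] at hl; omega)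
    · exact h1 l hm
  · refine fun H => ⟨fun l hl => ?_, fun l hl => ?_⟩
    · rw [mem_range_shiftFin] at hl
      exact H l (by omega)
    · exact H _ (by simp [shiftFin]; omega)

theorem opAt_two_zero (R : Matrix (Fin N × Fin N) (Fin N × Fin N) α) :
    opAt N 2 R 0 = R.submatrix (finTwoArrowEquiv (Fin N)) (finTwoArrowEquiv (Fin N)) := by
  ext a b
  rw [opAt, dif_pos (by norm_num), Matrix.of_apply, if_pos]
  · rfl
  · intro l
    omega

theorem opAt_mul_opAt_of_mul_eq_one {R S : Matrix (Fin N × Fin N) (Fin N × Fin N) α}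
    (h : R * S = 1) (i : ℕ) : opAt N k R i * opAt N k S i = 1 := by
  by_cases hi : i + 1 < k
  · have hk : i + 2 ≤ k := hi
    rw [show i = i + 0 from rfl, ← embAt_shiftFin_opAt R hk one_lt_two,
      ← embAt_shiftFin_opAt S hk one_lt_two, ← embAt_mul (shiftFin_injective hk), opAt_two_zero,
      opAt_two_zero, Matrix.submatrix_mul_equiv, h, Matrix.submatrix_one_equiv, embAt_one]
  · simp [opAt, hi]

theorem opAt_reflection {R : Matrix (Fin N × Fin N) (Fin N × Fin N) α}
    {X : Matrix (Fin N) (Fin N) α} (hX : RErel N R X) (hk : 1 < k) :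
    opAt N k R 0 * matAt N k X 0 * opAt N k R 0 * matAt N k X 0 =
      matAt N k X 0 * opAt N k R 0 * matAt N k X 0 * opAt N k R 0 := by
  have hk' : 0 + 2 ≤ k := by omega
  have h := congrArg (embAt (shiftFin hk')) hX
  simpa only [embAt_mul (shiftFin_injective hk'), embAt_shiftFin_opAt R hk' one_lt_two,
    embAt_shiftFin_matAt X hk' two_pos, add_zero] using h

end Embedding

section Numeric

variable {A : Type*} [Ring A] [Algebra ℂ A] {N k : ℕ}

theorem toA_mul {ι : Type*} [Fintype ι] (X Y : Matrix ι ι ℂ) :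
    toA A (X * Y) = toA A X * toA A Y :=
  Matrix.map_mul

theorem toA_one {ι : Type*} [Fintype ι] [DecidableEq ι] :
    toA A (1 : Matrix ι ι ℂ) = 1 :=
  Matrix.map_one _ (map_zero _) (map_one _)

theorem opAt_toA (R : Matrix (Fin N × Fin N) (Fin N × Fin N) ℂ) (i : ℕ) :
    opAt N k (toA A R) i = toA A (opAt N k R i) := by
  unfold opAt
  split_ifs with h
  · ext a b
    simp only [toA, Matrix.of_apply, Matrix.map_apply]
    split_ifs <;> simp
  · exact toA_one.symm

theorem commute_opAt_toA (R : Matrix (Fin N × Fin N) (Fin N × Fin N) ℂ) (i : ℕ)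
    (a b : Fin k → Fin N) (x : A) : Commute (opAt N k (toA A R) i a b) x := by
  rw [opAt_toA]
  exact Algebra.commutes _ x

theorem opAt_braid {R : Matrix (Fin N × Fin N) (Fin N × Fin N) ℂ} (hR : IsBraid N R) (i : ℕ)
    (hi : i + 2 < k) :
    opAt N k (toA A R) i * opAt N k (toA A R) (i + 1) * opAt N k (toA A R) i =
      opAt N k (toA A R) (i + 1) * opAt N k (toA A R) i * opAt N k (toA A R) (i + 1) := by
  have hk : i + 3 ≤ k := hi
  have h := congrArg (fun M => embAt (shiftFin hk) (toA A M)) hR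
  simpa only [toA_mul, ← opAt_toA, embAt_mul (shiftFin_injective hk),
    embAt_shiftFin_opAt (toA A R) hk (show 0 + 1 < 3 by norm_num),
    embAt_shiftFin_opAt (toA A R) hk (show 1 + 1 < 3 by norm_num), add_zero] using h

theorem commute_opAt_opAt (R : Matrix (Fin N × Fin N) (Fin N × Fin N) ℂ) {i j : ℕ}
    (hij : i + 1 < j) (hj : j + 1 < k) :
    Commute (opAt N k (toA A R) j) (opAt N k (toA A R) i) := by
  have hi' : i + 2 ≤ k := by omega
  have hj' : j + 2 ≤ k := hj
  rw [← add_zero i, ← add_zero j, ← embAt_shiftFin_opAt _ hi' one_lt_two,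
    ← embAt_shiftFin_opAt _ hj' one_lt_two]
  exact commute_embAt (disjoint_range_shiftFin hi' hj' hij).symm
    fun _ _ _ _ => commute_opAt_toA _ _ _ _ _

theorem commute_opAt_matAt (R : Matrix (Fin N × Fin N) (Fin N × Fin N) ℂ)
    (X : Matrix (Fin N) (Fin N) A) {j : ℕ} (h0 : 0 < j) (hj : j + 1 < k) :
    Commute (opAt N k (toA A R) j) (matAt N k X 0) := by
  have hi' : 0 + 1 ≤ k := by omega
  have hj' : j + 2 ≤ k := hj
  have hX := embAt_shiftFin_matAt X hi' one_pos
  rw [add_zero] at hX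
  rw [← add_zero j, ← embAt_shiftFin_opAt _ hj' one_lt_two, ← hX]
  exact commute_embAt (disjoint_range_shiftFin hi' hj' (by omega)).symm
    fun _ _ _ _ => commute_opAt_toA _ _ _ _ _

end Numeric

/-- For any `X` satisfying the reflection-equation relation, the
underline and overline copies satisfy `X_{[n]} X_{[n−1]} ⋯ X_{[1]} = X_{⟨1⟩} X_{⟨2⟩} ⋯ X_{⟨n⟩}`
in `Mat_{N^n}(A)` for every `n ≥ 1`. -/
theorem stmt3 {A : Type*} [Ring A] [Algebra ℂ A] (N : ℕ) (hN : 1 ≤ N) (q : ℂ)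
    (hq : GenericQ q)
    (R Rinv : Matrix (Fin N × Fin N) (Fin N × Fin N) ℂ)
    (hRinv : R * Rinv = 1 ∧ Rinv * R = 1)
    (hbraid : IsBraid N R) (hHecke : IsHecke N q R)
    (X : Matrix (Fin N) (Fin N) A)
    (hX : RErel N (toA A R) X)
    (n : ℕ) (hn : 1 ≤ n) :
    ((List.range n).reverse.map (unCopy N n (toA A R) (toA A Rinv) X)).prod =
      ovProd N n (toA A R) (toA A Rinv) X n := by
  have h1 : toA A R * toA A Rinv = 1 := by rw [← toA_mul, hRinv.1, toA_one]
  have h2 : toA A Rinv * toA A R = 1 := by rw [← toA_mul, hRinv.2, toA_one]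
  let g : ℕ → (Matrix (Fin n → Fin N) (Fin n → Fin N) A)ˣ := fun i =>
    ⟨opAt N n (toA A R) i, opAt N n (toA A Rinv) i, opAt_mul_opAt_of_mul_eq_one h1 i,
      opAt_mul_opAt_of_mul_eq_one h2 i⟩
  exact prod_underline_eq_prod_overline (k := n) (g := g)
    (o := ovCopy N n (toA A R) (toA A Rinv) X) (u := unCopy N n (toA A R) (toA A Rinv) X)
    (fun i hi => Units.ext (opAt_braid hbraid i hi))
    (fun i j hij hj => Units.ext (commute_opAt_opAt R hij hj))
    (fun j h0 hj => commute_opAt_matAt R X h0 hj)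
    (fun hk => opAt_reflection hX hk) rfl (fun _ => rfl) (fun _ => rfl) n le_rfl
end
end
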